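/- For every finite bipartite graph G=(A,B,E): α(G) = |A| + δ₀(B) = |B| + δ₀(A) = μ(G) + δ₀(A) + δ₀(B) = μ(G) + d_c(G). -/

import Mathlib

open Finset

open scoped Classical

variable {V : Type*} [Fintype V] [DecidableEq V]

/-- The neighborhood `N(X)` of a finite set of vertices `X`. -/
noncomputable def nbr (G : SimpleGraph V) (X : Finset V) : Finset V :=
  Finset.univ.filter fun v => ∃ x ∈ X, G.Adj v x

/-- The difference `d(X) = |X| - |N(X)|` of a set of vertices. -/
noncomputable def diffZ (G : SimpleGraph V) (X : Finset V) : ℤ :=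
  (X.card : ℤ) - ((nbr G X).card : ℤ)

/-- The critical difference `d_c(G) = max {d(X) : X ⊆ V}`. -/
noncomputable def critDiff (G : SimpleGraph V) : ℤ :=
  (Finset.univ : Finset V).powerset.sup' (Finset.powerset_nonempty _) (diffZ G)

/-- A set of vertices is independent if no two of its vertices are adjacent. -/
def IsIndep (G : SimpleGraph V) (S : Finset V) : Prop :=
  ∀ u ∈ S, ∀ v ∈ S, ¬ G.Adj u v

/-- The independence number `α(G)`. -/
noncomputable def indepNum (G : SimpleGraph V) : ℕ :=
  ((Finset.univ : Finset V).powerset.filter (IsIndep G)).sup Finset.card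

/-- The critical independence difference `id_c(G) = max {d(I) : I independent}`. -/
noncomputable def idc (G : SimpleGraph V) : ℤ :=
  ((Finset.univ : Finset V).powerset.filter (IsIndep G)).sup'
    ⟨∅, by simp [IsIndep]⟩ (diffZ G)

/-- A critical independent set: an independent set `S` with `d(S) = id_c(G)`. -/
def CritIndep (G : SimpleGraph V) (S : Finset V) : Prop :=
  IsIndep G S ∧ diffZ G S = idc G

/-- A finite set of edges of `G` that are pairwise non-incident (a matching). -/
def IsMatchingSet (G : SimpleGraph V) (M : Finset (Sym2 V)) : Prop :=
  (∀ e ∈ M, e ∈ G.edgeSet) ∧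
    (M : Set (Sym2 V)).Pairwise fun e f => ∀ v : V, ¬(v ∈ e ∧ v ∈ f)

/-- The matching number `μ(G)`. -/
noncomputable def matchNum (G : SimpleGraph V) : ℕ :=
  ((Finset.univ : Finset (Sym2 V)).powerset.filter (IsMatchingSet G)).sup Finset.card

/-- A maximum independent set. -/
def IsMaxIndep (G : SimpleGraph V) (S : Finset V) : Prop :=
  IsIndep G S ∧ S.card = indepNum G

/-- `ker(G)`: the intersection of all critical independent sets. -/
noncomputable def kerSet (G : SimpleGraph V) : Finset V :=
  Finset.univ.filter fun v => ∀ S : Finset V, CritIndep G S → v ∈ S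

/-- `diadem(G)`: the union of all critical independent sets. -/
noncomputable def diademSet (G : SimpleGraph V) : Finset V :=
  Finset.univ.filter fun v => ∃ S : Finset V, CritIndep G S ∧ v ∈ S

/-- `core(G)`: the intersection of all maximum independent sets. -/
noncomputable def coreSet (G : SimpleGraph V) : Finset V :=
  Finset.univ.filter fun v => ∀ S : Finset V, IsMaxIndep G S → v ∈ S

/-- `corona(G)`: the union of all maximum independent sets. -/
noncomputable def coronaSet (G : SimpleGraph V) : Finset V :=
  Finset.univ.filter fun v => ∃ S : Finset V, IsMaxIndep G S ∧ v ∈ S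

/-- `δ₀(A) = max {δ(X) : X ⊆ A}`, the maximum deficiency over subsets of a side. -/
noncomputable def delta0 (G : SimpleGraph V) (A : Finset V) : ℤ :=
  A.powerset.sup' (Finset.powerset_nonempty _) (diffZ G)

/-- An `A`-critical set: a subset `X ⊆ A` with `δ(X) = δ₀(A)`. -/
def SideCrit (G : SimpleGraph V) (A X : Finset V) : Prop :=
  X ⊆ A ∧ diffZ G X = delta0 G A

/-- `ker_A(G)`: the intersection of all `A`-critical sets. -/
noncomputable def kerSide (G : SimpleGraph V) (A : Finset V) : Finset V :=
  Finset.univ.filter fun v => ∀ X : Finset V, SideCrit G A X → v ∈ X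

/-- `diadem_A(G)`: the union of all `A`-critical sets. -/
noncomputable def diademSide (G : SimpleGraph V) (A : Finset V) : Finset V :=
  Finset.univ.filter fun v => ∃ X : Finset V, SideCrit G A X ∧ v ∈ X

/-- `{A, B}` is a bipartition of `G`: both sides nonempty, disjoint, covering all
vertices, and every edge goes between `A` and `B`. -/
def IsBipartition (G : SimpleGraph V) (A B : Finset V) : Prop :=
  A.Nonempty ∧ B.Nonempty ∧ Disjoint A B ∧ A ∪ B = Finset.univ ∧
    ∀ u v : V, G.Adj u v → (u ∈ A ∧ v ∈ B) ∨ (u ∈ B ∧ v ∈ A)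

set_option linter.unusedSectionVars false

lemma mem_nbr {G : SimpleGraph V} {X : Finset V} {v : V} :
    v ∈ nbr G X ↔ ∃ x ∈ X, G.Adj v x := by
  simp [nbr]

lemma IsBipartition.symm {G : SimpleGraph V} {A B : Finset V} (h : IsBipartition G A B) :
    IsBipartition G B A := by
  obtain ⟨hA, hB, hd, hu, he⟩ := h
  exact ⟨hB, hA, hd.symm, by rw [union_comm]; exact hu, fun u v huv => (he u v huv).symm⟩

lemma IsBipartition.mem_or_mem {G : SimpleGraph V} {A B : Finset V} (h : IsBipartition G A B)
    (v : V) : v ∈ A ∨ v ∈ B := by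
  have hv := mem_univ v
  rw [← h.2.2.2.1] at hv
  simpa using hv

lemma IsBipartition.mem_right {G : SimpleGraph V} {A B : Finset V} (h : IsBipartition G A B)
    {u v : V} (hu : u ∈ A) (huv : G.Adj u v) : v ∈ B := by
  rcases h.2.2.2.2 u v huv with h' | h'
  · exact h'.2
  · exact absurd h'.1 (disjoint_left.mp h.2.2.1 hu)

lemma IsBipartition.nbr_subset {G : SimpleGraph V} {A B X : Finset V} (h : IsBipartition G A B)
    (hX : X ⊆ A) : nbr G X ⊆ B := by
  intro v hv
  obtain ⟨x, hx, hvx⟩ := mem_nbr.mp hv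
  exact h.mem_right (hX hx) hvx.symm

lemma diffZ_le_delta0 (G : SimpleGraph V) {A X : Finset V} (hX : X ⊆ A) :
    diffZ G X ≤ delta0 G A :=
  le_sup' (diffZ G) (mem_powerset.mpr hX)

lemma exists_diffZ_eq_delta0 (G : SimpleGraph V) (A : Finset V) :
    ∃ X ⊆ A, diffZ G X = delta0 G A := by
  obtain ⟨X, hX, h⟩ := exists_mem_eq_sup' (powerset_nonempty A) (diffZ G)
  exact ⟨X, mem_powerset.mp hX, h.symm⟩

lemma delta0_nonneg (G : SimpleGraph V) (A : Finset V) : 0 ≤ delta0 G A := by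
  simpa [diffZ, nbr] using diffZ_le_delta0 G (empty_subset A)

lemma IsIndep.card_le_indepNum {G : SimpleGraph V} {S : Finset V} (hS : IsIndep G S) :
    S.card ≤ indepNum G :=
  le_sup (f := Finset.card) (by simpa using hS)

lemma exists_isMaxIndep (G : SimpleGraph V) : ∃ S, IsMaxIndep G S := by
  obtain ⟨S, hS, h⟩ := exists_mem_eq_sup ((univ : Finset V).powerset.filter (IsIndep G))
    ⟨∅, by simp [IsIndep]⟩ Finset.card
  exact ⟨S, (mem_filter.mp hS).2, h.symm⟩

lemma IsMatchingSet.card_le_matchNum {G : SimpleGraph V} {M : Finset (Sym2 V)}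
    (hM : IsMatchingSet G M) : M.card ≤ matchNum G :=
  le_sup (f := Finset.card) (by simpa using hM)

lemma exists_isMatchingSet_card_eq (G : SimpleGraph V) :
    ∃ M, IsMatchingSet G M ∧ M.card = matchNum G := by
  obtain ⟨M, hM, h⟩ := exists_mem_eq_sup
    ((univ : Finset (Sym2 V)).powerset.filter (IsMatchingSet G))
    ⟨∅, by simp [IsMatchingSet]⟩ Finset.card
  exact ⟨M, (mem_filter.mp hM).2, h.symm⟩

lemma IsBipartition.indepNum_eq {G : SimpleGraph V} {A B : Finset V} (h : IsBipartition G A B) :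
    (indepNum G : ℤ) = A.card + delta0 G B := by
  apply le_antisymm
  · obtain ⟨S, hS, hcard⟩ := exists_isMaxIndep G
    have hY := diffZ_le_delta0 G (inter_subset_right : S ∩ B ⊆ B)
    have hsub : (S ∩ A) ∪ nbr G (S ∩ B) ⊆ A :=
      union_subset inter_subset_right (h.symm.nbr_subset inter_subset_right)
    have hdisj : Disjoint (S ∩ A) (nbr G (S ∩ B)) := by
      rw [disjoint_left]
      intro v hv hv'
      obtain ⟨x, hx, hvx⟩ := mem_nbr.mp hv'
      exact hS v (mem_inter.mp hv).1 x (mem_inter.mp hx).1 hvx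
    have h₁ := card_le_card hsub
    rw [card_union_of_disjoint hdisj] at h₁
    have h₂ : S.card ≤ (S ∩ A).card + (S ∩ B).card := by
      rw [← card_union_of_disjoint (h.2.2.1.mono inter_subset_right inter_subset_right)]
      refine card_le_card fun v hv => ?_
      have := h.mem_or_mem v
      simp only [mem_union, mem_inter]
      tauto
    unfold diffZ at hY
    omega
  · obtain ⟨Y, hY, hYd⟩ := exists_diffZ_eq_delta0 G B
    have hind : IsIndep G ((A \ nbr G Y) ∪ Y) := by
      intro u hu v hv huv
      rw [mem_union, mem_sdiff, mem_nbr] at hu hv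
      rcases hu with hu | hu <;> rcases hv with hv | hv
      · exact disjoint_left.mp h.2.2.1 hv.1 (h.mem_right hu.1 huv)
      · exact hu.2 ⟨v, hv, huv⟩
      · exact hv.2 ⟨u, hu, huv.symm⟩
      · exact disjoint_left.mp h.2.2.1 (h.symm.mem_right (hY hu) huv) (hY hv)
    have hle := hind.card_le_indepNum
    rw [card_union_of_disjoint (h.2.2.1.mono sdiff_subset hY)] at hle
    have hc := card_sdiff_add_card_eq_card (h.symm.nbr_subset hY)
    unfold diffZ at hYd
    omega

/-- Weak duality: a matching is no larger than a vertex cover. -/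
lemma IsMatchingSet.card_le_of_cover {G : SimpleGraph V} {M : Finset (Sym2 V)}
    (hM : IsMatchingSet G M) {C : Finset V} (hC : ∀ u v, G.Adj u v → u ∈ C ∨ v ∈ C) :
    M.card ≤ C.card := by
  have hex : ∀ e ∈ M, ∃ v ∈ C, v ∈ e := by
    intro e he
    induction e with
    | _ u v =>
      rcases hC u v (by simpa using hM.1 _ he) with h | h
      · exact ⟨u, h, by simp⟩
      · exact ⟨v, h, by simp⟩
  rcases isEmpty_or_nonempty V with hV | hV
  · simp [eq_empty_of_isEmpty M]
  choose! f hf using hex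
  refine card_le_card_of_injOn f (fun e he => (hf e he).1) fun e he e' he' hee => ?_
  by_contra hne
  exact hM.2 he he' hne (f e) ⟨(hf e he).2, hee ▸ (hf e' he').2⟩

/-- The deficiency version of Hall's theorem: all but `δ₀(A)` vertices of `A` can be matched. -/
lemma IsBipartition.card_le_matchNum_add {G : SimpleGraph V} {A B : Finset V}
    (h : IsBipartition G A B) : (A.card : ℤ) ≤ matchNum G + delta0 G A := by
  obtain ⟨D, hD⟩ := Int.eq_ofNat_of_zero_le (delta0_nonneg G A)
  let t : A → Finset (V ⊕ Fin D) := fun a => (nbr G {a.1}).disjSum univ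
  have hall : ∀ s : Finset A, s.card ≤ (s.biUnion t).card := by
    intro s
    rcases s.eq_empty_or_nonempty with rfl | ⟨a₀, ha₀⟩
    · simp
    have hsub : (nbr G (s.map (Function.Embedding.subtype _))).disjSum univ ⊆ s.biUnion t := by
      intro x hx
      rw [mem_biUnion]
      rcases x with v | i
      · rw [inl_mem_disjSum, mem_nbr] at hx
        obtain ⟨x, hx, hvx⟩ := hx
        obtain ⟨a, ha, rfl⟩ := mem_map.mp hx
        exact ⟨a, ha, inl_mem_disjSum.mpr (mem_nbr.mpr ⟨a, by simp, hvx⟩)⟩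
      · exact ⟨a₀, ha₀, by simp [t]⟩
    have hle := card_le_card hsub
    have hd := diffZ_le_delta0 G (A := A) (X := s.map (Function.Embedding.subtype _)) (by
      intro x hx
      obtain ⟨a, -, rfl⟩ := mem_map.mp hx
      exact a.2)
    rw [card_disjSum, card_univ, Fintype.card_fin] at hle
    rw [diffZ, card_map] at hd
    omega
  obtain ⟨f, hf, hft⟩ := (Finset.all_card_le_biUnion_card_iff_exists_injective t).mp hall
  let T : Finset A := univ.filter fun a => ∃ v, f a = Sum.inl v
  have hT : ∀ a ∈ T, ∃ v, f a = Sum.inl v := fun a ha => (mem_filter.mp ha).2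
  have : ∃ g : A → V, ∀ a ∈ T, f a = Sum.inl (g a) := by
    refine ⟨fun a => Sum.elim id (fun _ => a.1) (f a), fun a ha => ?_⟩
    obtain ⟨v, hv⟩ := hT a ha
    simp [hv]
  obtain ⟨g, hg⟩ := this
  have hadj : ∀ a ∈ T, G.Adj a.1 (g a) := by
    intro a ha
    have hm := hft a
    rw [hg a ha, inl_mem_disjSum, mem_nbr] at hm
    obtain ⟨x, hx, hax⟩ := hm
    rw [mem_singleton] at hx
    exact hx ▸ hax.symm
  have hne : ∀ a b : A, b ∈ T → a.1 ≠ g b := fun a b hb hab =>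
    disjoint_left.mp h.2.2.1 a.2 (hab ▸ h.mem_right b.2 (hadj b hb))
  have hshare : ∀ a ∈ T, ∀ b ∈ T, ∀ v, v ∈ s(a.1, g a) → v ∈ s(b.1, g b) → a = b := by
    intro a ha b hb v hva hvb
    rw [Sym2.mem_iff] at hva hvb
    rcases hva with rfl | rfl <;> rcases hvb with hvb | hvb
    · exact Subtype.ext hvb
    · exact absurd hvb (hne a b hb)
    · exact absurd hvb.symm (hne b a ha)
    · exact hf (by rw [hg a ha, hg b hb, hvb])
  have hM : IsMatchingSet G (T.image fun a => s(a.1, g a)) := by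
    constructor
    · intro e he
      obtain ⟨a, ha, rfl⟩ := mem_image.mp he
      exact hadj a ha
    · intro e he e' he' hee v hv
      obtain ⟨a, ha, rfl⟩ := mem_image.mp he
      obtain ⟨b, hb, rfl⟩ := mem_image.mp he'
      exact hee (by rw [hshare a ha b hb v hv.1 hv.2])
  have hcard := hM.card_le_matchNum
  rw [card_image_of_injOn fun a ha b hb hab =>
    hshare a ha b hb a.1 (by simp) ((congrArg (a.1 ∈ ·) hab).mp (Sym2.mem_mk_left _ _))] at hcard
  have hcompl : Tᶜ.card ≤ D := by
    have hsub : Tᶜ.image f ⊆ (univ : Finset (Fin D)).map Function.Embedding.inr := by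
      intro x hx
      obtain ⟨a, ha, rfl⟩ := mem_image.mp hx
      rcases hfa : f a with v | i
      · exact absurd (mem_filter.mpr ⟨mem_univ a, v, hfa⟩) (mem_compl.mp ha)
      · simp
    simpa [card_image_of_injective _ hf] using card_le_card hsub
  have htot := card_add_card_compl T
  rw [Fintype.card_coe] at htot
  omega

lemma IsBipartition.matchNum_add_delta0 {G : SimpleGraph V} {A B : Finset V}
    (h : IsBipartition G A B) : (matchNum G : ℤ) + delta0 G A = A.card := by
  refine le_antisymm ?_ h.card_le_matchNum_add
  obtain ⟨M, hM, hcard⟩ := exists_isMatchingSet_card_eq G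
  obtain ⟨X, hX, hXd⟩ := exists_diffZ_eq_delta0 G A
  have hcov : ∀ u ∈ A, ∀ v, G.Adj u v → u ∈ (A \ X) ∪ nbr G X ∨ v ∈ (A \ X) ∪ nbr G X := by
    intro u hu v huv
    by_cases hx : u ∈ X
    · exact Or.inr (mem_union_right _ (mem_nbr.mpr ⟨u, hx, huv.symm⟩))
    · exact Or.inl (mem_union_left _ (mem_sdiff.mpr ⟨hu, hx⟩))
  have hle := hM.card_le_of_cover (C := (A \ X) ∪ nbr G X) fun u v huv => by
    rcases h.2.2.2.2 u v huv with ⟨hu, -⟩ | ⟨-, hv⟩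
    · exact hcov u hu v huv
    · exact (hcov v hv u huv.symm).symm
  have hu := card_union_le (A \ X) (nbr G X)
  have hs := card_sdiff_add_card_eq_card hX
  unfold diffZ at hXd
  omega

lemma nbr_union (G : SimpleGraph V) (X Y : Finset V) :
    nbr G (X ∪ Y) = nbr G X ∪ nbr G Y := by
  ext v
  simp only [mem_nbr, mem_union]
  grind

lemma IsBipartition.diffZ_union {G : SimpleGraph V} {A B X Y : Finset V}
    (h : IsBipartition G A B) (hX : X ⊆ A) (hY : Y ⊆ B) :
    diffZ G (X ∪ Y) = diffZ G X + diffZ G Y := by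
  unfold diffZ
  rw [nbr_union, card_union_of_disjoint (h.2.2.1.mono hX hY),
    card_union_of_disjoint (h.2.2.1.symm.mono (h.nbr_subset hX) (h.symm.nbr_subset hY))]
  push_cast
  ring

lemma IsBipartition.critDiff_eq {G : SimpleGraph V} {A B : Finset V} (h : IsBipartition G A B) :
    critDiff G = delta0 G A + delta0 G B := by
  apply le_antisymm
  · refine sup'_le _ _ fun Z _ => ?_
    have hZ : Z = (Z ∩ A) ∪ (Z ∩ B) := by
      ext v
      have := h.mem_or_mem v
      simp only [mem_union, mem_inter]
      tauto
    rw [hZ, h.diffZ_union inter_subset_right inter_subset_right]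
    exact add_le_add (diffZ_le_delta0 G inter_subset_right) (diffZ_le_delta0 G inter_subset_right)
  · obtain ⟨X, hX, hXd⟩ := exists_diffZ_eq_delta0 G A
    obtain ⟨Y, hY, hYd⟩ := exists_diffZ_eq_delta0 G B
    rw [← hXd, ← hYd, ← h.diffZ_union hX hY]
    exact diffZ_le_delta0 G (subset_univ _)

/-- For every finite bipartite graph `G = (A,B,E)`:
`α(G) = |A| + δ₀(B) = |B| + δ₀(A) = μ(G) + δ₀(A) + δ₀(B) = μ(G) + d_c(G)`. -/
theorem indepNum_eq_card_add_delta0 (G : SimpleGraph V) (A B : Finset V)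
    (hbip : IsBipartition G A B) :
    (indepNum G : ℤ) = (A.card : ℤ) + delta0 G B ∧
    (indepNum G : ℤ) = (B.card : ℤ) + delta0 G A ∧
    (indepNum G : ℤ) = (matchNum G : ℤ) + delta0 G A + delta0 G B ∧
    (indepNum G : ℤ) = (matchNum G : ℤ) + critDiff G := by
  have hα := hbip.indepNum_eq
  have hμ := hbip.matchNum_add_delta0
  have hc := hbip.critDiff_eq
  exact ⟨hα, hbip.symm.indepNum_eq, by omega, by omega⟩
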